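/- Let λ, η ∈ [0,1] and for T ≥ 1 define p(T) = λ·[1 + Σ_{k=2}^{T} Σ_{j=2}^{k} C(k-2, j-2)·((1-λ)·η)^{j-1}·(1-η)^{k-j}]. Then the sequence p is nondecreasing in T and 0 ≤ p(T) ≤ 1 for every T ≥ 1. -/

import Mathlib

open Finset

theorem sum_Icc_two_choose_mul_pow (a b : ℝ) (m : ℕ) :
    ∑ j ∈ Finset.Icc 2 (m + 2), (Nat.choose (m + 2 - 2) (j - 2) : ℝ) * a ^ (j - 1)
      * b ^ (m + 2 - j) = a * (a + b) ^ m := by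
  rw [add_pow, Finset.mul_sum, ← Finset.Ico_add_one_right_eq_Icc, Finset.sum_Ico_eq_sum_range]
  refine Finset.sum_congr (congrArg Finset.range (by omega)) fun i _ => ?_
  rw [show m + 2 - 2 = m by omega, show 2 + i - 2 = i by omega,
    show 2 + i - 1 = i + 1 by omega, show m + 2 - (2 + i) = m - i by omega]
  ring

/-- Closed form of the pose-coverage formula. -/
theorem pose_coverage_closed_form (lam eta : ℝ) (n : ℕ) :
    lam * (1 + ∑ k ∈ Finset.Icc 2 (n + 1), ∑ j ∈ Finset.Icc 2 k,
        (Nat.choose (k - 2) (j - 2) : ℝ) * ((1 - lam) * eta) ^ (j - 1)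
          * (1 - eta) ^ (k - j)) = 1 - (1 - lam) * (1 - lam * eta) ^ n := by
  induction n with
  | zero => simp
  | succ n ih =>
    rw [Finset.sum_Icc_succ_top (by omega), ← add_assoc, mul_add, ih,
      sum_Icc_two_choose_mul_pow,
      show (1 - lam) * eta + (1 - eta) = 1 - lam * eta by ring]
    ring

/-- The encounter probability `p T` of a stable pose of probability `lam` within
`T` steps (with grasp-success probability `eta` on other poses), given by the
pose-coverage formula, is nondecreasing in `T` and lies in `[0, 1]`. -/
theorem pose_coverage_monotone_and_bounded
    (lam eta : ℝ) (hlam : lam ∈ Set.Icc (0:ℝ) 1) (heta : eta ∈ Set.Icc (0:ℝ) 1)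
    (p : ℕ → ℝ)
    (hp : ∀ T : ℕ, 1 ≤ T →
      p T = lam * (1 + ∑ k ∈ Finset.Icc 2 T, ∑ j ∈ Finset.Icc 2 k,
        (Nat.choose (k - 2) (j - 2) : ℝ) * ((1 - lam) * eta) ^ (j - 1)
          * (1 - eta) ^ (k - j))) :
    (∀ T : ℕ, 1 ≤ T → p T ≤ p (T + 1)) ∧
    (∀ T : ℕ, 1 ≤ T → 0 ≤ p T ∧ p T ≤ 1) := by
  obtain ⟨hl0, hl1⟩ := hlam
  obtain ⟨he0, he1⟩ := heta
  have hp' (n : ℕ) : p (n + 1) = 1 - (1 - lam) * (1 - lam * eta) ^ n := by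
    rw [hp (n + 1) (by omega), pose_coverage_closed_form]
  have hr0 : 0 ≤ 1 - lam * eta := sub_nonneg.2 (mul_le_one₀ hl1 he0 he1)
  have hr1 : 1 - lam * eta ≤ 1 := sub_le_self _ (mul_nonneg hl0 he0)
  have hl : 0 ≤ 1 - lam := sub_nonneg.2 hl1
  refine ⟨fun T hT => ?_, fun T hT => ?_⟩
  · obtain ⟨n, rfl⟩ := Nat.exists_eq_add_of_le' hT
    rw [hp', hp']
    exact sub_le_sub_left
      (mul_le_mul_of_nonneg_left (pow_le_pow_of_le_one hr0 hr1 n.le_succ) hl) 1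
  · obtain ⟨n, rfl⟩ := Nat.exists_eq_add_of_le' hT
    rw [hp']
    exact ⟨sub_nonneg.2 (mul_le_one₀ (sub_le_self _ hl0) (pow_nonneg hr0 n)
      (pow_le_one₀ hr0 hr1)), sub_le_self _ (mul_nonneg hl (pow_nonneg hr0 n))⟩
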